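/- Let φ be a Sturmian coloring of a d-regular tree. For each n-ball N_n(x), the n-balls adjacent to N_n(x) (i.e. with center at distance 1 from x) belong to at most two classes of n-balls apart from [N_n(x)] itself. Consequently, for any class D of n-balls with D ≠ S_n, there are at most two classes of n-balls that can be adjacent to D apart from D. -/

import Mathlib

open scoped Classical

noncomputable section

namespace Sturm

variable {V α : Type}

/-- `G` is a `d`-regular tree. -/
structure IsRegularTree (G : SimpleGraph V) (d : ℕ) : Prop where
  isTree : G.IsTree
  regular : ∀ v : V, (G.neighborSet v).ncard = d

/-- Color-preserving isomorphism of the `n`-balls centered at `x` and `y`,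
sending center to center. -/
def BallEquiv (G : SimpleGraph V) (φ : V → α) (n : ℕ) (x y : V) : Prop :=
  ∃ f : {z : V // G.dist x z ≤ n} ≃ {z : V // G.dist y z ≤ n},
    (∀ u v : {z : V // G.dist x z ≤ n}, G.Adj u.1 v.1 ↔ G.Adj (f u).1 (f v).1) ∧
    (∀ u : {z : V // G.dist x z ≤ n}, φ (f u).1 = φ u.1) ∧
    ((f ⟨x, by rw [SimpleGraph.dist_self]; exact Nat.zero_le n⟩).1 = y)

/-- The class of the `n`-ball at `x`, viewed as the set of all centers of equivalent balls. -/
def ballClass (G : SimpleGraph V) (φ : V → α) (n : ℕ) (x : V) : Set V :=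
  {y | BallEquiv G φ n x y}

/-- The set `B_n(φ)` of classes of `n`-balls occurring in `(T, φ)`. -/
def ballClasses (G : SimpleGraph V) (φ : V → α) (n : ℕ) : Set (Set V) :=
  {C | ∃ x, C = ballClass G φ n x}

/-- A coloring is Sturmian if its factor complexity is `n + 2`. -/
def IsSturmian (G : SimpleGraph V) (φ : V → α) : Prop :=
  ∀ n, (ballClasses G φ n).ncard = n + 2

/-- `x` is the center of a special `n`-ball. -/
def IsSpecialVert (G : SimpleGraph V) (φ : V → α) (n : ℕ) (x : V) : Prop :=
  ∃ y, BallEquiv G φ n x y ∧ ¬ BallEquiv G φ (n + 1) x y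

/-- `S` is a special class of `n`-balls: the restriction of two distinct classes of
`(n+1)`-balls. -/
def IsSpecialClass (G : SimpleGraph V) (φ : V → α) (n : ℕ) (S : Set V) : Prop :=
  ∃ x, S = ballClass G φ n x ∧ IsSpecialVert G φ n x

/-- The class `D` is always adjacent to the class `E`. -/
def AlwaysAdjTo (G : SimpleGraph V) (D E : Set V) : Prop :=
  ∀ x ∈ D, ∃ y, G.Adj x y ∧ y ∈ E

/-- The classes `D` and `E` are (always) adjacent. -/
def AlwaysAdj (G : SimpleGraph V) (D E : Set V) : Prop :=
  AlwaysAdjTo G D E ∧ AlwaysAdjTo G E D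

/-- The classes `D` and `E` can be adjacent. -/
def CanAdj (G : SimpleGraph V) (D E : Set V) : Prop :=
  ∃ x ∈ D, ∃ y ∈ E, G.Adj x y

/-- The number of neighbors of `x` lying in (i.e. being centers of balls of class) `E`. -/
def nbrCount (G : SimpleGraph V) (x : V) (E : Set V) : ℕ :=
  (G.neighborSet x ∩ E).ncard

/-- The data of the labels `S_n, C_n, A_n, B_n` for a Sturmian coloring, normalized as in
the paper: `S_0 = A_0 = [a]`, `B_0 = [b]`, `A_{n+1}` (resp. `B_{n+1}`) is always adjacent
to `A_n` (resp. `B_n`), and `A_{n+1}, B_{n+1}` are the two distinct extensions of `S_n`. -/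
structure Labeling (G : SimpleGraph V) (φ : V → α) (a b : α) where
  S : ℕ → Set V
  C : ℕ → Set V
  A : ℕ → Set V
  B : ℕ → Set V
  S_special : ∀ n, IsSpecialClass G φ n (S n)
  C_central : ∀ n, ∃ x, IsSpecialVert G φ (n + 1) x ∧ S (n + 1) = ballClass G φ (n + 1) x ∧
      C n = ballClass G φ n x
  A0_eq_S0 : A 0 = S 0
  A0_col : ∃ x, φ x = a ∧ A 0 = ballClass G φ 0 x
  B0_col : ∃ x, φ x = b ∧ B 0 = ballClass G φ 0 x
  A_ext : ∀ n, ∃ x, IsSpecialVert G φ n x ∧ S n = ballClass G φ n x ∧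
      A (n + 1) = ballClass G φ (n + 1) x
  B_ext : ∀ n, ∃ x, IsSpecialVert G φ n x ∧ S n = ballClass G φ n x ∧
      B (n + 1) = ballClass G φ (n + 1) x
  AB_ne : ∀ n, A (n + 1) ≠ B (n + 1)
  A_adj : ∀ n, AlwaysAdjTo G (A (n + 1)) (A n)
  B_adj : ∀ n, AlwaysAdjTo G (B (n + 1)) (B n)

/-- A cycle (of length `≥ 3`, with pairwise distinct vertices) in the graph `G_n` of
classes of `n`-balls, where classes are joined when they can be adjacent. -/
def IsCycleIn (G : SimpleGraph V) (φ : V → α) (n k : ℕ) (c : ℕ → Set V) : Prop :=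
  3 ≤ k ∧ (∀ i < k, c i ∈ ballClasses G φ n) ∧
    (∀ i < k, CanAdj G (c i) (c ((i + 1) % k))) ∧
    (∀ i < k, ∀ j < k, c i = c j → i = j)

/-- The graph `G_n` contains a cycle. -/
def HasCycle (G : SimpleGraph V) (φ : V → α) (n : ℕ) : Prop :=
  ∃ k c, IsCycleIn G φ n k c

/-! ## Edge-indexed colored graphs -/

/-- An edge-indexed graph, with vertices colored by `α` and labeled by classes
(sets of vertices of the underlying tree `V`). Index `0` means "no edge". -/
structure EIG (V α : Type) where
  Vert : Type
  idx : Vert → Vert → ℕ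
  col : Vert → α
  lab : Vert → Set V

/-- Isomorphism of colored edge-indexed graphs. -/
structure EIGIso (X Y : EIG V α) where
  e : X.Vert ≃ Y.Vert
  idx_eq : ∀ u v, Y.idx (e u) (e v) = X.idx u v
  col_eq : ∀ u, Y.col (e u) = X.col u

/-- The index `i_A(D, E)` (resp. `i_B`, `i`) at the level of classes: the number of
neighbors, in class `E`, of a representative center of `D`; when `D` is the special
class `Sp`, the representative is taken with extension of class `Ext`. -/
def classIdx (G : SimpleGraph V) (Sp Ext : Set V) (D E : Set V) : ℕ :=
  if D = Sp then (if h : Ext.Nonempty then nbrCount G h.some E else 0)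
  else (if h : D.Nonempty then nbrCount G h.some E else 0)

/-- The classes of `n`-balls joined to `Sp` by a path of edges of positive `J`-index. -/
def reachSet (G : SimpleGraph V) (φ : V → α) (n : ℕ) (Sp : Set V)
    (J : Set V → Set V → ℕ) : Set (Set V) :=
  {D | ∃ k, ∃ c : ℕ → Set V, c 0 = Sp ∧ c k = D ∧ (∀ i ≤ k, c i ∈ ballClasses G φ n) ∧
    ∀ i < k, 0 < J (c i) (c (i + 1)) ∨ 0 < J (c (i + 1)) (c i)}

/-- Color of a class: the color of (the center of) any of its representatives. -/
def colOf [Nonempty V] (φ : V → α) (D : Set V) : α :=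
  if h : D.Nonempty then φ h.some else φ (Classical.arbitrary V)

/-- The edge-indexed graph `G^A_n` (when `Ext = A_{n+1}`) resp. `G^B_n`. -/
def sideEIG [Nonempty V] (G : SimpleGraph V) (φ : V → α) (n : ℕ) (Sp Ext : Set V) :
    EIG V α where
  Vert := {D : Set V // D ∈ reachSet G φ n Sp (classIdx G Sp Ext)}
  idx := fun D E => classIdx G Sp Ext D.1 E.1
  col := fun D => colOf φ D.1
  lab := fun D => D.1

variable {G : SimpleGraph V} {φ : V → α} {a b : α}

/-- The edge-indexed graph `G^A_n`. -/
def GAeig [Nonempty V] (L : Labeling G φ a b) (n : ℕ) : EIG V α :=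
  sideEIG G φ n (L.S n) (L.A (n + 1))

/-- The edge-indexed graph `G^B_n`. -/
def GBeig [Nonempty V] (L : Labeling G φ a b) (n : ℕ) : EIG V α :=
  sideEIG G φ n (L.S n) (L.B (n + 1))

/-- Vertex set of `G^A_n`. -/
def VGAset (L : Labeling G φ a b) (n : ℕ) : Set (Set V) :=
  reachSet G φ n (L.S n) (classIdx G (L.S n) (L.A (n + 1)))

/-- Vertex set of `G^B_n`. -/
def VGBset (L : Labeling G φ a b) (n : ℕ) : Set (Set V) :=
  reachSet G φ n (L.S n) (classIdx G (L.S n) (L.B (n + 1)))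

/-- `G^A_n` or `G^B_n`, selected by a letter (`true = A`, `false = B`). -/
def GsideEIG [Nonempty V] (L : Labeling G φ a b) (n : ℕ) : Bool → EIG V α
  | true => GAeig L n
  | false => GBeig L n

/-- Vertex set of `G^A_n` or `G^B_n`, selected by a letter. -/
def VGside (L : Labeling G φ a b) (n : ℕ) : Bool → Set (Set V)
  | true => VGAset L n
  | false => VGBset L n

/-- A single vertex with a loop of index `d` (the graph `G^A_{-1} = G^B_{-1} = F^._{-1}`). -/
def baseEIG (V : Type) (x : α) (d : ℕ) : EIG V α where
  Vert := PUnit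
  idx := fun _ _ => d
  col := fun _ => x
  lab := fun _ => Set.univ

/-- `GAx L d (n+1) = G^A_n`, and `GAx L d 0 = G^A_{-1}`. -/
def GAx [Nonempty V] (L : Labeling G φ a b) (d : ℕ) : ℕ → EIG V α
  | 0 => baseEIG V a d
  | n + 1 => GAeig L n

/-- `GBx L d (n+1) = G^B_n`, and `GBx L d 0 = G^B_{-1}`. -/
def GBx [Nonempty V] (L : Labeling G φ a b) (d : ℕ) : ℕ → EIG V α
  | 0 => baseEIG V b d
  | n + 1 => GBeig L n

/-- `Cx L (n+1) = C_n`, and `Cx L 0 = C_{-1}` (the class of the empty ball). -/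
def Cx (L : Labeling G φ a b) : ℕ → Set V
  | 0 => Set.univ
  | n + 1 => L.C n

/-! ## Concatenations -/

/-- The `(i)`-concatenation of two edge-indexed graphs at the end vertices `v, v'`
(which are identified). -/
def concatI (X Y : EIG V α) (v : X.Vert) (v' : Y.Vert) (i : ℕ) : EIG V α where
  Vert := X.Vert ⊕ {w : Y.Vert // w ≠ v'}
  idx := fun p q =>
    match p, q with
    | Sum.inl u, Sum.inl w =>
        if u = v ∧ w ≠ v then (if X.idx u w = 0 then 0 else i) else X.idx u w
    | Sum.inl u, Sum.inr w => if u = v then Y.idx v' w.1 - i else 0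
    | Sum.inr w, Sum.inl u => if u = v then Y.idx w.1 v' else 0
    | Sum.inr w, Sum.inr w2 => Y.idx w.1 w2.1
  col := Sum.elim X.col (fun w => Y.col w.1)
  lab := Sum.elim X.lab (fun w => Y.lab w.1)

/-- The `(i,j)`-concatenation of two edge-indexed graphs at the end vertices `v, v'`
(which stay distinct, joined by a new edge of indices `i`, `j`). -/
def concatIJ (X Y : EIG V α) (v : X.Vert) (v' : Y.Vert) (i j : ℕ) : EIG V α where
  Vert := X.Vert ⊕ Y.Vert
  idx := fun p q =>
    match p, q with
    | Sum.inl u, Sum.inl w => if u = v ∧ w = v then X.idx v v - i else X.idx u w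
    | Sum.inl u, Sum.inr w => if u = v ∧ w = v' then i else 0
    | Sum.inr w, Sum.inl u => if w = v' ∧ u = v then j else 0
    | Sum.inr u, Sum.inr w => if u = v' ∧ w = v' then Y.idx v' v' - j else Y.idx u w
  col := Sum.elim X.col Y.col
  lab := Sum.elim X.lab Y.lab

/-- `Z` is a concatenation ((i)- or (i,j)-) of `X` and `Y` at `(vX, vY)`. -/
def IsConcatOfAt (Z X Y : EIG V α) (vX : X.Vert) (vY : Y.Vert) : Prop :=
  (∃ i, 1 ≤ i ∧ Nonempty (EIGIso Z (concatI X Y vX vY i))) ∨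
  (∃ i j, 1 ≤ i ∧ 1 ≤ j ∧ Nonempty (EIGIso Z (concatIJ X Y vX vY i j)))

/-! ## Paths, distance, degree in edge-indexed graphs -/

/-- Adjacency (by an edge of positive index, in one of the two orientations). -/
def EIGAdj (X : EIG V α) (u w : X.Vert) : Prop :=
  u ≠ w ∧ (0 < X.idx u w ∨ 0 < X.idx w u)

/-- There is a path of length `L` from `u` to `w`. -/
def EIGReach (X : EIG V α) (u w : X.Vert) (L : ℕ) : Prop :=
  ∃ c : ℕ → X.Vert, c 0 = u ∧ c L = w ∧ ∀ i < L, EIGAdj X (c i) (c (i + 1))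

/-- Graph distance in an edge-indexed graph. -/
def EIGDist (X : EIG V α) (u w : X.Vert) : ℕ :=
  sInf {L | EIGReach X u w L}

/-- `u` has degree one: there is exactly one vertex adjacent to it. -/
def EIGEndVert (X : EIG V α) (u : X.Vert) : Prop :=
  ∃! w, EIGAdj X u w

/-! ## Coverings, direct limits, quotient graph, bounded type -/

/-- `p` exhibits the graph `H` as the universal cover of the edge-indexed graph `Y`:
above a vertex mapping to `u`, the number of neighbors above `w` is the index `idx u w`. -/
def IsEIGCover {W : Type} (H : SimpleGraph W) (Y : EIG V α) (p : W → Y.Vert) : Prop :=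
  ∀ x : W, ∀ u : Y.Vert, (H.neighborSet x ∩ p ⁻¹' {u}).ncard = Y.idx (p x) u

/-- `Y` is the direct limit of the system `F` of colored edge-indexed graphs along the
inclusions `ι`. -/
def IsDirLimit (F : ℕ → EIG V α) (ι : ∀ k, (F k).Vert → (F (k + 1)).Vert)
    (Y : EIG V α) : Prop :=
  ∃ j : ∀ k, (F k).Vert → Y.Vert,
    (∀ k v, j (k + 1) (ι k v) = j k v) ∧
    (∀ k, Function.Injective (j k)) ∧
    (∀ y, ∃ k v, j k v = y) ∧
    (∀ k v, Y.col (j k v) = (F k).col v) ∧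
    (∀ y z : Y.Vert, ∃ N, ∀ k, N ≤ k → ∀ v w, j k v = y → j k w = z →
      Y.idx y z = (F k).idx v w)

/-- The coloring `φ` is of bounded type: every vertex has finite type set. -/
def BoundedType (G : SimpleGraph V) (φ : V → α) : Prop :=
  ∀ v : V, {m : ℕ | IsSpecialVert G φ m v}.Finite

/-- Two vertices are related if some color-preserving automorphism maps one to the other. -/
def colorOrbitRel (G : SimpleGraph V) (φ : V → α) (x y : V) : Prop :=
  ∃ g : V ≃ V, (∀ u w, G.Adj u w ↔ G.Adj (g u) (g w)) ∧ (∀ u, φ (g u) = φ u) ∧ g x = y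

/-- The quotient graph `X_φ = G\T` as a colored edge-indexed graph. -/
def quotEIG (G : SimpleGraph V) (φ : V → α) : EIG V α where
  Vert := Quot (colorOrbitRel G φ)
  idx := fun u w => (G.neighborSet u.out ∩ {z | Quot.mk (colorOrbitRel G φ) z = w}).ncard
  col := fun u => φ u.out
  lab := fun u => {z | Quot.mk (colorOrbitRel G φ) z = u}

/-! ## The sequences `n_k`, `α_k`, `β_k` -/

/-- At level `n`, one of `A_n, B_n` is `S_n` or `C_n`. -/
def SpecTouch (L : Labeling G φ a b) (n : ℕ) : Prop :=
  L.A n = L.S n ∨ L.A n = L.C n ∨ L.B n = L.S n ∨ L.B n = L.C n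

/-- `nk` is the increasing enumeration of the levels where `SpecTouch` holds. -/
def IsNkSeq (L : Labeling G φ a b) (nk : ℕ → ℕ) : Prop :=
  StrictMono nk ∧ ∀ n, (∃ k, nk k = n) ↔ SpecTouch L n

/-- `αs` is the sequence `α_k`: `α_K = A`, and for `k ≠ K`, `α_k` is the side whose
graph `G^{α_k}_{n_k}` has more vertices. -/
def IsAlphaSeq (L : Labeling G φ a b) (nk : ℕ → ℕ) (K : ℕ∞) (αs : ℕ → Bool) : Prop :=
  ∀ k : ℕ, ((k : ℕ∞) = K → αs k = true) ∧
    ((k : ℕ∞) ≠ K → (αs k = true ↔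
      (VGside L (nk k) false).ncard < (VGside L (nk k) true).ncard))

/-- The sequence `β_k(t)`: `β_{k-1}(t)` is the letter `ᾱ_k` if the class of the
`n_k`-ball at `t` is a vertex of `G^{ᾱ_k}_{n_k}`, and `α_k` otherwise. -/
def betaOf (L : Labeling G φ a b) (nk : ℕ → ℕ) (αs : ℕ → Bool) (t : V) (k : ℕ) : Bool :=
  if ballClass G φ (nk (k + 1)) t ∈ VGside L (nk (k + 1)) (!(αs (k + 1))) then
    !(αs (k + 1))
  else αs (k + 1)

end Sturm

namespace Sturm

/-! ## Isomorphisms of balls -/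

section Balls

variable {V α : Type} {G : SimpleGraph V} {φ : V → α}

theorem BallEquiv.refl (n : ℕ) (x : V) : BallEquiv G φ n x x :=
  ⟨Equiv.refl _, fun _ _ => Iff.rfl, fun _ => rfl, rfl⟩

theorem BallEquiv.symm {n : ℕ} {x y : V} (h : BallEquiv G φ n x y) : BallEquiv G φ n y x := by
  obtain ⟨f, hadj, hcol, hc⟩ := h
  refine ⟨f.symm, fun u v => ?_, fun u => ?_, ?_⟩
  · simpa using (hadj (f.symm u) (f.symm v)).symm
  · simpa using (hcol (f.symm u)).symm
  · have : f.symm ⟨y, by rw [SimpleGraph.dist_self]; exact Nat.zero_le n⟩ =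
        ⟨x, by rw [SimpleGraph.dist_self]; exact Nat.zero_le n⟩ := by
      rw [Equiv.symm_apply_eq]
      exact Subtype.ext hc.symm
    rw [this]

theorem BallEquiv.trans {n : ℕ} {x y z : V} (h : BallEquiv G φ n x y)
    (h' : BallEquiv G φ n y z) : BallEquiv G φ n x z := by
  obtain ⟨f, hadj, hcol, hc⟩ := h
  obtain ⟨g, hadj', hcol', hc'⟩ := h'
  refine ⟨f.trans g, fun u v => (hadj u v).trans (hadj' _ _),
    fun u => (hcol' _).trans (hcol u), ?_⟩
  have : f ⟨x, by rw [SimpleGraph.dist_self]; exact Nat.zero_le n⟩ =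
      ⟨y, by rw [SimpleGraph.dist_self]; exact Nat.zero_le n⟩ := Subtype.ext hc
  rw [Equiv.trans_apply, this, hc']

theorem ballClass_eq_iff {n : ℕ} {x y : V} :
    ballClass G φ n x = ballClass G φ n y ↔ BallEquiv G φ n x y := by
  constructor
  · intro h
    have : y ∈ ballClass G φ n y := BallEquiv.refl n y
    rwa [← h] at this
  · intro h
    ext z
    exact ⟨fun hz => h.symm.trans hz, fun hz => h.trans hz⟩

theorem exists_adj_dist_le (hG : G.Connected) {k : ℕ} {u z : V} (huz : u ≠ z)
    (hz : G.dist u z ≤ k + 1) : ∃ w, G.dist u w ≤ k ∧ G.Adj w z := by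
  obtain ⟨p, hp⟩ := hG.exists_walk_length_eq_dist z u
  cases p with
  | nil => exact absurd rfl huz
  | @cons _ w _ h q =>
    refine ⟨w, ?_, h.symm⟩
    have h1 := SimpleGraph.dist_le q
    rw [SimpleGraph.Walk.length_cons, SimpleGraph.dist_comm] at hp
    rw [SimpleGraph.dist_comm]
    omega

/-- A map between balls preserving adjacency does not increase distances within a ball
contained in its source. -/
theorem dist_map_le (hG : G.Connected) {N : ℕ} {x x' : V}
    (f : {z : V // G.dist x z ≤ N} → {z : V // G.dist x' z ≤ N})
    (hf : ∀ u v, G.Adj u.1 v.1 → G.Adj (f u).1 (f v).1) (u : {z : V // G.dist x z ≤ N}) (k : ℕ) :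
    G.dist x u + k ≤ N → ∀ z : {z : V // G.dist x z ≤ N}, G.dist u.1 z.1 ≤ k →
      G.dist (f u).1 (f z).1 ≤ k := by
  induction k with
  | zero =>
    intro _ z hz
    have : u = z := Subtype.ext ((hG.dist_eq_zero_iff).1 (Nat.le_zero.1 hz))
    simp [this]
  | succ k ih =>
    intro hk z hz
    by_cases huz : u.1 = z.1
    · have : u = z := Subtype.ext huz
      simp [this]
    · obtain ⟨w, hw, hwz⟩ := exists_adj_dist_le hG huz hz
      have hxw : G.dist x w ≤ N := by
        have := hG.dist_triangle (u := x) (v := u.1) (w := w)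
        omega
      have h1 := ih (by omega) ⟨w, hxw⟩ hw
      have h2 := SimpleGraph.dist_eq_one_iff_adj.2 (hf ⟨w, hxw⟩ z hwz)
      have := hG.dist_triangle (u := (f u).1) (v := (f ⟨w, hxw⟩).1) (w := (f z).1)
      omega

theorem BallEquiv.restrict (hG : G.Connected) {N k : ℕ} {x x' : V}
    (f : {z : V // G.dist x z ≤ N} ≃ {z : V // G.dist x' z ≤ N})
    (hadj : ∀ u v : {z : V // G.dist x z ≤ N}, G.Adj u.1 v.1 ↔ G.Adj (f u).1 (f v).1)
    (hcol : ∀ u : {z : V // G.dist x z ≤ N}, φ (f u).1 = φ u.1)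
    (hc : (f ⟨x, by rw [SimpleGraph.dist_self]; exact Nat.zero_le N⟩).1 = x')
    (u : {z : V // G.dist x z ≤ N}) (hu : G.dist x u.1 + k ≤ N) :
    BallEquiv G φ k u.1 (f u).1 := by
  have hadj' : ∀ u v : {z : V // G.dist x' z ≤ N},
      G.Adj u.1 v.1 → G.Adj (f.symm u).1 (f.symm v).1 := fun u v h => by
    rw [hadj]; simpa using h
  have hfu : G.dist x' (f u).1 ≤ G.dist x u.1 := by
    have := dist_map_le hG f (fun u v => (hadj u v).1)
      ⟨x, by rw [SimpleGraph.dist_self]; exact Nat.zero_le N⟩ (G.dist x u.1)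
      (by rw [SimpleGraph.dist_self]; omega) u le_rfl
    rwa [hc] at this
  have hsrc : ∀ z, G.dist u.1 z ≤ k → G.dist x z ≤ N := fun z hz => by
    have := hG.dist_triangle (u := x) (v := u.1) (w := z)
    omega
  have htgt : ∀ z, G.dist (f u).1 z ≤ k → G.dist x' z ≤ N := fun z hz => by
    have := hG.dist_triangle (u := x') (v := (f u).1) (w := z)
    omega
  refine ⟨⟨fun z => ⟨(f ⟨z.1, hsrc _ z.2⟩).1, ?_⟩, fun z => ⟨(f.symm ⟨z.1, htgt _ z.2⟩).1, ?_⟩,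
    fun z => ?_, fun z => ?_⟩, fun v w => hadj ⟨v.1, hsrc _ v.2⟩ ⟨w.1, hsrc _ w.2⟩,
    fun v => hcol ⟨v.1, hsrc _ v.2⟩, rfl⟩
  · exact dist_map_le hG f (fun u v => (hadj u v).1) u k hu _ z.2
  · have := dist_map_le hG f.symm hadj' (f u) k (by omega) ⟨z.1, htgt _ z.2⟩ z.2
    simpa using this
  · simp
  · simp

theorem BallEquiv.of_succ (hG : G.Connected) {n : ℕ} {x y : V}
    (h : BallEquiv G φ (n + 1) x y) : BallEquiv G φ n x y := by
  obtain ⟨f, hadj, hcol, hc⟩ := h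
  have := BallEquiv.restrict (k := n) hG f hadj hcol hc
    ⟨x, by rw [SimpleGraph.dist_self]; exact Nat.zero_le _⟩
    (by rw [SimpleGraph.dist_self]; omega)
  rwa [hc] at this

theorem BallEquiv.exists_adj (hG : G.Connected) {n : ℕ} {x x' y : V}
    (h : BallEquiv G φ (n + 1) x x') (hxy : G.Adj x y) :
    ∃ y', G.Adj x' y' ∧ BallEquiv G φ n y y' := by
  obtain ⟨f, hadj, hcol, hc⟩ := h
  have hd := SimpleGraph.dist_eq_one_iff_adj.2 hxy
  refine ⟨(f ⟨y, by omega⟩).1, ?_,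
    BallEquiv.restrict (k := n) hG f hadj hcol hc ⟨y, by omega⟩ (by simp only [hd]; omega)⟩
  have := (hadj ⟨x, by rw [SimpleGraph.dist_self]; exact Nat.zero_le _⟩ ⟨y, by omega⟩).1 hxy
  rwa [hc] at this

end Balls

/-! ## Refining sequences of partitions with one splitting class per step -/

theorem pair_eq_of_surjective_of_card {A B : Type*} [Finite A] {f : A → B}
    (hf : Function.Surjective f) (hcard : Nat.card A = Nat.card B + 1) {a a' c c' : A}
    (ha : f a = f a') (haa : a ≠ a') (hc : f c = f c') (hcc : c ≠ c') : c = a ∨ c' = a := by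
  have : Finite B := Finite.of_surjective f hf
  by_contra! h
  let g : {z : A // z ≠ a} → B := fun z => f z.1
  have hg : Function.Surjective g := by
    intro b
    obtain ⟨z, rfl⟩ := hf b
    by_cases hz : z = a
    · exact ⟨⟨a', haa.symm⟩, by simp [g, hz, ha]⟩
    · exact ⟨⟨z, hz⟩, rfl⟩
  have : Fintype A := Fintype.ofFinite A
  have : Fintype B := Fintype.ofFinite B
  have hcard' : Nat.card {z : A // z ≠ a} = Nat.card B := by
    have : Fintype.card {z : A // z ≠ a} = Fintype.card A - 1 := by
      simp
    rw [Nat.card_eq_fintype_card] at *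
    omega
  have hinj : Function.Injective g := (hg.bijective_of_nat_card_le hcard'.le).1
  exact hcc (congrArg Subtype.val (@hinj ⟨c, h.1⟩ ⟨c', h.2⟩ hc))

/-- A refining sequence of partitions of the vertices of a connected locally finite graph with
`n + 2` classes at level `n`, in which the class of a vertex at level `n + 1` determines which
classes of level `n` it is adjacent to. -/
structure SturmianRefinement {V : Type} (G : SimpleGraph V) (r : ℕ → Setoid V) : Prop where
  connected : G.Connected
  finite_neighborSet : ∀ v, (G.neighborSet v).Finite
  of_succ : ∀ {n x y}, r (n + 1) x y → r n x y
  exists_adj : ∀ {n x x' y}, r (n + 1) x x' → G.Adj x y → ∃ y', G.Adj x' y' ∧ r n y y'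
  card_quotient : ∀ n, Nat.card (Quotient (r n)) = n + 2

/-- The class of `x` at level `n` splits at level `n + 1`. -/
def Splits {V : Type} (r : ℕ → Setoid V) (n : ℕ) (x : V) : Prop :=
  ∃ y, r n x y ∧ ¬ r (n + 1) x y

/-- The class of `x` at level `m` meets infinitely many of the splitting classes. -/
def MeetsInfinitely {V : Type} (r : ℕ → Setoid V) (m : ℕ) (x : V) : Prop :=
  {n | ∃ z, r m x z ∧ Splits r n z}.Infinite

theorem forall_of_adj_of_connected {V : Type*} {G : SimpleGraph V}
    (hG : G.Connected) {P : V → Prop} (hP : ∀ u v, G.Adj u v → P u → P v) {x : V} (hx : P x)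
    (y : V) : P y := by
  obtain ⟨p⟩ := hG.preconnected x y
  induction p with
  | nil => exact hx
  | cons hadj _ ih => exact ih (hP _ _ hadj hx)

/-- The level from which on the class of `x` no longer splits. -/
def settle {V : Type} (r : ℕ → Setoid V) (x : V) : ℕ :=
  sInf {t | ∀ m, t ≤ m → ¬ Splits r m x}

section Refinement

variable {V : Type} {r : ℕ → Setoid V}

theorem succ_of_not_splits {n : ℕ} {x y : V} (hx : ¬ Splits r n x)
    (hxy : r n x y) : r (n + 1) x y := by
  by_contra hn
  exact hx ⟨y, hxy, hn⟩

theorem Splits.congr {n : ℕ} {x y : V} (hx : Splits r n x) (hxy : r n x y) :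
    Splits r n y := by
  obtain ⟨z, hz, hz'⟩ := hx
  by_cases hyx : r (n + 1) y x
  · exact ⟨z, (r n).trans ((r n).symm hxy) hz,
      fun hyz => hz' ((r (n + 1)).trans ((r (n + 1)).symm hyx) hyz)⟩
  · exact ⟨x, (r n).symm hxy, hyx⟩

theorem exists_not_splits {x : V} (hx : {m | Splits r m x}.Finite) :
    ∃ t, ∀ m, t ≤ m → ¬ Splits r m x := by
  obtain ⟨b, hb⟩ := hx.bddAbove
  exact ⟨b + 1, fun m hm hs => by have := hb hs; omega⟩

theorem not_splits_of_settle_le {x : V} (hx : {m | Splits r m x}.Finite) :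
    ∀ m, settle r x ≤ m → ¬ Splits r m x :=
  Nat.sInf_mem (exists_not_splits hx)

theorem splits_of_settle_eq_succ {x : V} {s : ℕ} (hs : settle r x = s + 1) : Splits r s x := by
  have hlt : s < settle r x := by omega
  have hmem := Nat.notMem_of_lt_sInf hlt
  have hpos : settle r x ∈ {t | ∀ m, t ≤ m → ¬ Splits r m x} :=
    Nat.sInf_mem (Nat.nonempty_of_pos_sInf (Nat.zero_lt_of_lt hlt))
  simp only [Set.mem_ofPred_eq, not_forall, not_not] at hmem
  obtain ⟨m, hsm, hm⟩ := hmem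
  have : ¬ settle r x ≤ m := fun hle => hpos m hle hm
  obtain rfl : m = s := by omega
  exact hm

end Refinement

namespace SturmianRefinement

variable {V : Type} {G : SimpleGraph V} {r : ℕ → Setoid V}

theorem of_le (h : SturmianRefinement G r) {m n : ℕ} (hmn : m ≤ n) {x y : V} (hxy : r n x y) :
    r m x y := by
  induction n, hmn using Nat.le_induction with
  | base => exact hxy
  | succ n _ ih => exact ih (h.of_succ hxy)

theorem finite_quotient (h : SturmianRefinement G r) (n : ℕ) : Finite (Quotient (r n)) :=
  Nat.finite_of_card_ne_zero (by rw [h.card_quotient]; omega)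

theorem of_not_splits (h : SturmianRefinement G r) {m n : ℕ} {x y : V}
    (hx : ∀ k, m ≤ k → ¬ Splits r k x) (hxy : r m x y) : r n x y := by
  rcases le_total n m with hnm | hmn
  · exact h.of_le hnm hxy
  · induction n, hmn using Nat.le_induction with
    | base => exact hxy
    | succ n hn ih => exact succ_of_not_splits (hx n hn) ih

/-- The projection from the classes of level `n + 1` to those of level `n`. -/
def proj (h : SturmianRefinement G r) (n : ℕ) : Quotient (r (n + 1)) → Quotient (r n) :=
  Quotient.map' id fun _ _ => h.of_succ

theorem proj_surjective (h : SturmianRefinement G r) (n : ℕ) :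
    Function.Surjective (h.proj n) := by
  rintro ⟨x⟩
  exact ⟨Quotient.mk _ x, rfl⟩

theorem eq_or_eq_of_splits (h : SturmianRefinement G r) {n : ℕ} {x x' z z' : V}
    (hx : r n x x') (hx' : ¬ r (n + 1) x x') (hz : r n z z') (hz' : ¬ r (n + 1) z z') :
    r (n + 1) z x ∨ r (n + 1) z' x := by
  have := h.finite_quotient (n + 1)
  have := pair_eq_of_surjective_of_card (h.proj_surjective n)
    (by rw [h.card_quotient, h.card_quotient])
    (a := Quotient.mk _ x) (a' := Quotient.mk _ x') (c := Quotient.mk _ z)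
    (c' := Quotient.mk _ z') (Quotient.sound hx) (fun e => hx' (Quotient.exact e))
    (Quotient.sound hz) (fun e => hz' (Quotient.exact e))
  exact this.imp (fun e => Quotient.exact e) (fun e => Quotient.exact e)

theorem equiv_of_splits (h : SturmianRefinement G r) {n : ℕ} {x z : V}
    (hx : Splits r n x) (hz : Splits r n z) : r n x z := by
  obtain ⟨x', hx, hx'⟩ := hx
  obtain ⟨z', hz, hz'⟩ := hz
  rcases h.eq_or_eq_of_splits hx hx' hz hz' with e | e
  · exact (r n).symm (h.of_succ e)
  · exact (r n).symm ((r n).trans hz (h.of_succ e))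

theorem succ_or_succ (h : SturmianRefinement G r) {n : ℕ} {x y z : V}
    (hxy : r n x y) (hxy' : ¬ r (n + 1) x y) (hxz : r n x z) :
    r (n + 1) x z ∨ r (n + 1) y z := by
  by_cases hxz' : r (n + 1) x z
  · exact Or.inl hxz'
  · right
    rcases h.eq_or_eq_of_splits ((r n).symm hxy) (fun e => hxy' ((r (n + 1)).symm e)) hxz hxz'
      with e | e
    · exact absurd e hxy'
    · exact (r (n + 1)).symm e

theorem exists_splits (h : SturmianRefinement G r) (n : ℕ) : ∃ x, Splits r n x := by
  by_contra! hn
  have := h.finite_quotient n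
  have hinj : Function.Injective (h.proj n) := by
    rintro ⟨x⟩ ⟨y⟩ hxy
    exact Quotient.sound (succ_of_not_splits (hn x) (Quotient.exact hxy))
  have := Nat.card_le_card_of_injective _ hinj
  rw [h.card_quotient, h.card_quotient] at this
  omega

theorem zero_of_not_splits (h : SturmianRefinement G r) {x y : V} (hx : ¬ Splits r 0 x)
    (hy : ¬ Splits r 0 y) : r 0 x y := by
  obtain ⟨s, hs⟩ := h.exists_splits 0
  by_contra hxy
  have := h.finite_quotient 0
  have : Fintype (Quotient (r 0)) := Fintype.ofFinite _
  have hcard := h.card_quotient 0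
  rw [Nat.card_eq_fintype_card] at hcard
  have h3 := Finset.card_le_univ
    ({Quotient.mk _ s, Quotient.mk _ x, Quotient.mk _ y} : Finset (Quotient (r 0)))
  rw [Finset.card_eq_three.2 ⟨_, _, _, fun e => hx (hs.congr (Quotient.exact e)),
    fun e => hy (hs.congr (Quotient.exact e)), fun e => hxy (Quotient.exact e), rfl⟩] at h3
  omega

/-- Two fixed vertices are separated at one level only. -/
theorem subsingleton_separation (h : SturmianRefinement G r) (x y : V) :
    {m | r m x y ∧ ¬ r (m + 1) x y}.Subsingleton := by
  rintro m ⟨hm, hm'⟩ n ⟨hn, hn'⟩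
  by_contra hne
  rcases Nat.lt_or_gt_of_ne hne with hlt | hlt
  · exact hm' (h.of_le hlt hn)
  · exact hn' (h.of_le hlt hm)

/-- A vertex with three neighbors in distinct classes other than its own is in finitely many
splitting classes. -/
theorem finite_splits_of_three (h : SturmianRefinement G r) {n : ℕ} {x : V} (y : Fin 3 → V)
    (hadj : ∀ i, G.Adj x (y i)) (hne : ∀ i, ¬ r n x (y i))
    (hinj : ∀ i j, r n (y i) (y j) → i = j) : {m | Splits r m x}.Finite := by
  have hfin : (⋃ u ∈ G.neighborSet x, ⋃ v ∈ G.neighborSet u,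
      {m | r m x v ∧ ¬ r (m + 1) x v}).Finite :=
    (h.finite_neighborSet x).biUnion fun u _ => (h.finite_neighborSet u).biUnion fun v _ =>
      (h.subsingleton_separation x v).finite
  refine ((Set.finite_lt_nat (n + 1)).union hfin).subset fun m hm => ?_
  by_cases hmn : m < n + 1
  · exact Or.inl hmn
  right
  obtain ⟨k, rfl⟩ : ∃ k, m = k + 1 := ⟨m - 1, by omega⟩
  have hsep : ∀ l, n ≤ l → ∀ i j, Splits r l (y i) → Splits r l (y j) → i = j :=
    fun l hl i j hi hj => hinj i j (h.of_le hl (h.equiv_of_splits hi hj))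
  obtain ⟨i, hi, hi'⟩ : ∃ i, ¬ Splits r k (y i) ∧ ¬ Splits r (k + 2) (y i) := by
    by_contra! hall
    have h01 := hsep k (by omega) 0 1
    have h02 := hsep k (by omega) 0 2
    have h12 := hsep k (by omega) 1 2
    have h01' := hsep (k + 2) (by omega) 0 1
    have h02' := hsep (k + 2) (by omega) 0 2
    have h12' := hsep (k + 2) (by omega) 1 2
    have a0 := hall 0
    have a1 := hall 1
    have a2 := hall 2
    simp only [Fin.reduceEq, imp_false] at *
    tauto
  have hi1 : ¬ Splits r (k + 1) (y i) := fun hs =>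
    hne i (h.of_le (by omega) (h.equiv_of_splits hm hs))
  obtain ⟨x', hx, hx'⟩ := hm
  obtain ⟨y', hy', hyy'⟩ := h.exists_adj hx (hadj i)
  have hyy : r (k + 3) (y i) y' :=
    succ_of_not_splits hi' (succ_of_not_splits hi1 (succ_of_not_splits hi hyy'))
  obtain ⟨x'', hx'', hxx''⟩ := h.exists_adj ((r _).symm hyy) hy'.symm
  simp only [Set.mem_iUnion]
  refine ⟨y i, hadj i, x'', hx'', (r _).trans hx (h.of_succ hxx''), fun e => hx' ?_⟩
  exact (r _).trans e ((r _).symm hxx'')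

/-- A vertex whose class has stopped splitting and which is adjacent to a splitting class is
adjacent to both of its parts. -/
theorem exists_adj_of_splits (h : SturmianRefinement G r) {t j : ℕ} {x y : V}
    (hx : ∀ m, t ≤ m → ¬ Splits r m x) (htj : t + 1 ≤ j) (hxy : G.Adj x y)
    (hy : Splits r j y) : ∃ y', G.Adj x y' ∧ r j y y' ∧ ¬ r (j + 1) y y' := by
  obtain ⟨k, rfl⟩ : ∃ k, j = k + 1 := ⟨j - 1, by omega⟩
  obtain ⟨y', hyy', hyy''⟩ := hy
  obtain ⟨x', hx', hxx'⟩ := h.exists_adj hyy' hxy.symm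
  have hxx : r (k + 3) x x' :=
    h.of_not_splits (m := k) (fun m hm => hx m (by omega)) hxx'
  obtain ⟨z, hz, hyz⟩ := h.exists_adj ((r _).symm hxx) hx'.symm
  exact ⟨z, hz, (r _).trans hyy' (h.of_succ hyz),
    fun e => hyy'' ((r _).trans e ((r _).symm hyz))⟩

theorem finite_splits_adj (h : SturmianRefinement G r) {x : V}
    (hx : {m | Splits r m x}.Finite) : {m | ∃ y, G.Adj x y ∧ Splits r m y}.Finite := by
  obtain ⟨t, ht⟩ := exists_not_splits hx
  have hfin : (⋃ u ∈ G.neighborSet x, ⋃ v ∈ G.neighborSet x,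
      {m | r m u v ∧ ¬ r (m + 1) u v}).Finite :=
    (h.finite_neighborSet x).biUnion fun u _ => (h.finite_neighborSet x).biUnion fun v _ =>
      (h.subsingleton_separation u v).finite
  refine ((Set.finite_lt_nat (t + 1)).union hfin).subset ?_
  rintro m ⟨y, hxy, hy⟩
  by_cases hmt : m < t + 1
  · exact Or.inl hmt
  obtain ⟨y', hy', hyy'⟩ := h.exists_adj_of_splits ht (by omega) hxy hy
  right
  simp only [Set.mem_iUnion]
  exact ⟨y, hxy, y', hy', hyy'⟩

theorem finite_splits (h : SturmianRefinement G r) {x : V} (hx : {m | Splits r m x}.Finite)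
    (y : V) : {m | Splits r m y}.Finite :=
  forall_of_adj_of_connected h.connected (P := fun v => {m | Splits r m v}.Finite)
    (fun _ v huv hu => (h.finite_splits_adj hu).subset fun _ hm => ⟨v, huv, hm⟩) hx y

theorem MeetsInfinitely.adj (h : SturmianRefinement G r)
    (hfin : ∀ x, {m | Splits r m x}.Finite) {m : ℕ} {e d : V} (hinf : MeetsInfinitely r m e)
    (he : ¬ Splits r m e) (hed : G.Adj e d) : MeetsInfinitely r m d := by
  by_contra hd
  obtain ⟨b, hb⟩ := (Set.not_infinite.1 hd).bddAbove
  have hd' : ∀ d', r m d d' → ∀ k, b + 1 ≤ k → ¬ Splits r k d' := fun d' hdd' k hk hs => by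
    have := hb ⟨d', hdd', hs⟩
    omega
  have := h.finite_quotient (b + 1)
  have hU : (⋃ q : Quotient (r (b + 1)), {n | ∃ y, G.Adj q.out y ∧ Splits r n y}).Finite :=
    Set.finite_iUnion fun q => h.finite_splits_adj (hfin _)
  refine hinf (hU.subset ?_)
  rintro n ⟨z, hez, hz⟩
  obtain ⟨d', hzd', hdd'⟩ := h.exists_adj (succ_of_not_splits he hez) hed
  have hq : r (n + 1) d' (Quotient.mk (r (b + 1)) d').out :=
    h.of_not_splits (hd' d' hdd')
      ((r (b + 1)).symm (Quotient.exact (Quotient.out_eq (Quotient.mk (r (b + 1)) d'))))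
  obtain ⟨z', hz', hzz'⟩ := h.exists_adj hq hzd'.symm
  exact Set.mem_iUnion.2 ⟨_, z', hz', hz.congr hzz'⟩

theorem meetsInfinitely_of_splits (h : SturmianRefinement G r)
    (hfin : ∀ x, {m | Splits r m x}.Finite) {m : ℕ} {x : V} (hx : Splits r m x) :
    MeetsInfinitely r m x := by
  by_contra hinf
  obtain ⟨e, he⟩ : ∃ e, MeetsInfinitely r m e := by
    by_contra! hall
    have := h.finite_quotient m
    refine Set.infinite_univ (α := ℕ) ((Set.finite_iUnion fun q : Quotient (r m) =>
      Set.not_infinite.1 (hall q.out)).subset fun n _ => ?_)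
    obtain ⟨z, hz⟩ := h.exists_splits n
    exact Set.mem_iUnion.2
      ⟨Quotient.mk _ z, z, Quotient.exact (Quotient.out_eq (Quotient.mk (r m) z)), hz⟩
  refine hinf (forall_of_adj_of_connected h.connected (P := MeetsInfinitely r m)
    (fun _ v huv hu => MeetsInfinitely.adj h hfin hu (fun hs => hinf (hu.mono ?_)) huv) he x)
  rintro n ⟨z, huz, hz⟩
  exact ⟨z, (r m).trans (h.equiv_of_splits hx hs) huz, hz⟩

theorem not_meetsInfinitely (h : SturmianRefinement G r) {t m : ℕ} {x : V}
    (hx : ∀ k, t ≤ k → ¬ Splits r k x) (htm : t ≤ m) : ¬ MeetsInfinitely r m x := by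
  refine Set.not_infinite.2 ((Set.finite_lt_nat m).subset ?_)
  rintro n ⟨z, hxz, hz⟩
  by_contra hn
  have hmn : m ≤ n := Nat.not_lt.1 hn
  exact hx n (htm.trans hmn) (hz.congr ((r n).symm
    (h.of_not_splits (m := m) (fun k hk => hx k (htm.trans hk)) hxz)))

theorem MeetsInfinitely.succ_or_succ (h : SturmianRefinement G r) {m : ℕ} {x y : V}
    (hinf : MeetsInfinitely r m x) (hxy : r m x y) (hxy' : ¬ r (m + 1) x y) :
    MeetsInfinitely r (m + 1) x ∨ MeetsInfinitely r (m + 1) y := by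
  refine Set.infinite_union.1 (hinf.mono ?_)
  rintro n ⟨z, hxz, hz⟩
  exact (h.succ_or_succ hxy hxy' hxz).imp (fun e => ⟨z, e, hz⟩) (fun e => ⟨z, e, hz⟩)

theorem not_splits_of_adj (h : SturmianRefinement G r)
    (hfin : ∀ x, {m | Splits r m x}.Finite) {t j : ℕ} {x y : V}
    (hx : ∀ m, t ≤ m → ¬ Splits r m x) (hxy : G.Adj x y) (htj : t + 1 ≤ j) :
    ¬ Splits r j y := by
  intro hy
  have hall : ∀ k, j ≤ k → ∃ z, G.Adj x z ∧ Splits r k z := by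
    intro k hk
    induction k, hk using Nat.le_induction with
    | base => exact ⟨y, hxy, hy⟩
    | succ k hk ih =>
      obtain ⟨z, hxz, hz⟩ := ih
      obtain ⟨z', hxz', hzz', hzz''⟩ := h.exists_adj_of_splits hx (htj.trans hk) hxz hz
      have key : ∀ w, G.Adj x w → MeetsInfinitely r (k + 1) w → Splits r (k + 1) w := by
        intro w hw hinf
        by_contra hs
        exact h.not_meetsInfinitely hx (by omega) (MeetsInfinitely.adj h hfin hinf hs hw.symm)
      rcases MeetsInfinitely.succ_or_succ h (h.meetsInfinitely_of_splits hfin hz) hzz' hzz''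
        with hinf | hinf
      · exact ⟨z, hxz, key z hxz hinf⟩
      · exact ⟨z', hxz', key z' hxz' hinf⟩
  exact (Set.Ici_infinite j) ((h.finite_splits_adj (hfin x)).subset hall)

/-- Settling times differ by at most one between neighbors. -/
theorem settle_le_of_adj (h : SturmianRefinement G r)
    (hfin : ∀ x, {m | Splits r m x}.Finite) {x y : V} (hxy : G.Adj x y) :
    settle r y ≤ settle r x + 1 :=
  Nat.sInf_le fun _ hm => h.not_splits_of_adj hfin (not_splits_of_settle_le (hfin x)) hxy hm

/-- The settling time determines all classes of a vertex. -/
theorem equiv_of_settle_eq (h : SturmianRefinement G r)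
    (hfin : ∀ x, {m | Splits r m x}.Finite) {x z : V} (hxz : settle r x = settle r z) (n : ℕ) :
    r n x z := by
  have hx := not_splits_of_settle_le (hfin x)
  have hz := not_splits_of_settle_le (hfin z)
  refine h.of_not_splits hx ?_
  cases ht : settle r x with
  | zero =>
    exact h.zero_of_not_splits (hx 0 ht.le) (hz 0 (hxz.symm.trans ht).le)
  | succ s =>
    have hxs := splits_of_settle_eq_succ ht
    have hzs := splits_of_settle_eq_succ (hxz.symm.trans ht)
    by_contra hne
    rcases MeetsInfinitely.succ_or_succ h (h.meetsInfinitely_of_splits hfin hxs)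
      (h.equiv_of_splits hxs hzs) hne with hinf | hinf
    · exact h.not_meetsInfinitely hx ht.le hinf
    · exact h.not_meetsInfinitely hz (hxz.symm.trans ht).le hinf

theorem not_three_adjacent (h : SturmianRefinement G r) {n : ℕ} {x : V} (y : Fin 3 → V)
    (hadj : ∀ i, G.Adj x (y i)) (hne : ∀ i, ¬ r n x (y i)) :
    ¬ ∀ i j, r n (y i) (y j) → i = j := by
  intro hinj
  have hfin := h.finite_splits (h.finite_splits_of_three y hadj hne hinj)
  have h1 : ∀ i, settle r (y i) ≤ settle r x + 1 := fun i => h.settle_le_of_adj hfin (hadj i)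
  have h2 : ∀ i, settle r x ≤ settle r (y i) + 1 :=
    fun i => h.settle_le_of_adj hfin (hadj i).symm
  have h3 : ∀ i, settle r x ≠ settle r (y i) := fun i e => hne i (h.equiv_of_settle_eq hfin e n)
  have h4 : ∀ i j, i ≠ j → settle r (y i) ≠ settle r (y j) :=
    fun i j hij e => hij (hinj i j (h.equiv_of_settle_eq hfin e n))
  have h01 := h4 0 1 (by decide)
  have h02 := h4 0 2 (by decide)
  have h12 := h4 1 2 (by decide)
  have := h1 0; have := h1 1; have := h1 2
  have := h2 0; have := h2 1; have := h2 2
  have := h3 0; have := h3 1; have := h3 2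
  omega

end SturmianRefinement

/-! ## Ball classes of Sturmian colorings -/

theorem ker_ballClass_apply {V α : Type} {G : SimpleGraph V} {φ : V → α} {n : ℕ} {x y : V} :
    Setoid.ker (ballClass G φ n) x y ↔ BallEquiv G φ n x y :=
  ballClass_eq_iff

theorem IsSturmian.refinement {V α : Type} {G : SimpleGraph V} {φ : V → α}
    (hSt : IsSturmian G φ) (hG : G.Connected) (hfin : ∀ v, (G.neighborSet v).Finite) :
    SturmianRefinement G fun n => Setoid.ker (ballClass G φ n) where
  connected := hG
  finite_neighborSet := hfin
  of_succ h := ker_ballClass_apply.2 ((ker_ballClass_apply.1 h).of_succ hG)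
  exists_adj h hxy := by
    simpa only [ker_ballClass_apply] using (ker_ballClass_apply.1 h).exists_adj hG hxy
  card_quotient n := by
    rw [Nat.card_congr (Setoid.quotientKerEquivRange _), ← hSt n, Nat.card_coe_set_eq]
    congr 1
    ext C
    exact ⟨fun ⟨x, hx⟩ => ⟨x, hx.symm⟩, fun ⟨x, hx⟩ => ⟨x, hx.symm⟩⟩

theorem exists_pair_of_not_three {β : Type*} [Nonempty β] {s : Set β}
    (hs : ∀ f : Fin 3 → β, (∀ i, f i ∈ s) → ¬ Function.Injective f) :
    ∃ D E, ∀ c ∈ s, c = D ∨ c = E := by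
  by_contra! hall
  obtain ⟨c₀, h₀, -⟩ := hall (Classical.arbitrary β) (Classical.arbitrary β)
  obtain ⟨c₁, h₁, h₁₀, -⟩ := hall c₀ c₀
  obtain ⟨c₂, h₂, h₂₀, h₂₁⟩ := hall c₀ c₁
  refine hs ![c₀, c₁, c₂] (fun i => ?_) (fun i j hij => ?_)
  · fin_cases i <;> assumption
  · fin_cases i <;> fin_cases j <;> simp_all [eq_comm]

theorem IsSturmian.exists_pair_of_adj {V α : Type} {G : SimpleGraph V} {φ : V → α}
    (hSt : IsSturmian G φ) (hG : G.Connected) (hfin : ∀ v, (G.neighborSet v).Finite) (n : ℕ)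
    (x : V) : ∃ D E : Set V, ∀ y : V, G.Adj x y →
      ballClass G φ n y = ballClass G φ n x ∨ ballClass G φ n y = D ∨
        ballClass G φ n y = E := by
  obtain ⟨D, E, hDE⟩ := exists_pair_of_not_three
    (s := {C | ∃ y, G.Adj x y ∧ ballClass G φ n y = C ∧ C ≠ ballClass G φ n x}) (by
      intro f hf hinj
      choose y hadj hy hne using hf
      refine (hSt.refinement hG hfin).not_three_adjacent (n := n) y hadj (fun i e => ?_)
        fun i j e => hinj ?_
      · exact hne i ((hy i).symm.trans (Eq.symm e))
      · rw [← hy i, ← hy j]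
        exact e)
  exact ⟨D, E, fun y hxy => or_iff_not_imp_left.2 fun hne => hDE _ ⟨y, hxy, rfl, hne⟩⟩

/-- Lemma 2.2 (2): in a Sturmian coloring, the `n`-balls adjacent to a
given `n`-ball belong to at most two classes apart from its own; consequently a
non-special class of `n`-balls can be adjacent to at most two classes apart from itself. -/
theorem at_most_two_adjacent_classes {V α : Type} (G : SimpleGraph V) (d : ℕ)
    (hd : 3 ≤ d) (hT : IsRegularTree G d) (φ : V → α) (hSt : IsSturmian G φ) (n : ℕ) :
    (∀ x : V, ∃ D E : Set V, ∀ y : V, G.Adj x y →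
      ballClass G φ n y = ballClass G φ n x ∨ ballClass G φ n y = D ∨
        ballClass G φ n y = E) ∧
    (∀ S : Set V, IsSpecialClass G φ n S → ∀ D ∈ ballClasses G φ n, D ≠ S →
      ∃ E F : Set V, ∀ E' ∈ ballClasses G φ n, CanAdj G D E' →
        E' = D ∨ E' = E ∨ E' = F) := by
  have hG : G.Connected := hT.isTree.connected
  have hfin : ∀ v, (G.neighborSet v).Finite := fun v =>
    Set.finite_of_ncard_pos (by rw [hT.regular]; omega)
  have hpair := hSt.exists_pair_of_adj hG hfin n
  refine ⟨hpair, ?_⟩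
  rintro S ⟨s, rfl, hs⟩ D ⟨x, rfl⟩ hDS
  obtain ⟨E, F, hEF⟩ := hpair x
  refine ⟨E, F, ?_⟩
  rintro E' ⟨z, rfl⟩ ⟨x', hx', y, hy, hxy⟩
  have hsucc : BallEquiv G φ (n + 1) x x' := by
    by_contra hne
    refine hDS (ballClass_eq_iff.2 (ker_ballClass_apply.1
      ((hSt.refinement hG hfin).equiv_of_splits (n := n) ?_ ?_)))
    · exact ⟨x', ker_ballClass_apply.2 hx', fun e => hne (ker_ballClass_apply.1 e)⟩
    · obtain ⟨s', hss', hs'⟩ := hs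
      exact ⟨s', ker_ballClass_apply.2 hss', fun e => hs' (ker_ballClass_apply.1 e)⟩
  obtain ⟨y', hxy', hyy'⟩ := hsucc.symm.exists_adj hG hxy
  rw [ballClass_eq_iff.2 (BallEquiv.trans hy hyy')]
  exact hEF y' hxy'

end Sturm
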